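/- For every pair of smooth functions α, β : V → (0,∞), the set Γ is a periodic orbit of the perturbed system dv/dt = X(v) − α(v)(H(v)−h)[∇C(v) × (∇H(v) × ∇C(v))] + β(v)(C(v)−c)[∇H(v) × (∇H(v) × ∇C(v))], v ∈ V, and Γ is orbitally phase asymptotically stable with respect to perturbations in V (i.e., with respect to all initial conditions in a full open neighborhood of Γ in V). -/

import Mathlib

open scoped RealInnerProductSpace

noncomputable section

abbrev E3 := EuclideanSpace ℝ (Fin 3)

/-- The cross product on `EuclideanSpace ℝ (Fin 3)`. -/
noncomputable def cross3 (a b : E3) : E3 :=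
  (WithLp.equiv 2 (Fin 3 → ℝ)).symm
    (crossProduct (WithLp.equiv 2 (Fin 3 → ℝ) a) (WithLp.equiv 2 (Fin 3 → ℝ) b))

/-- `x` is a forward-in-time solution of `v' = Y v` in `V` with `x 0 = x₀`. -/
def IsForwardSolution {E : Type*} [NormedAddCommGroup E] [NormedSpace ℝ E]
    (Y : E → E) (V : Set E) (x₀ : E) (x : ℝ → E) : Prop :=
  x 0 = x₀ ∧ ∀ t : ℝ, 0 ≤ t → x t ∈ V ∧ HasDerivWithinAt x (Y (x t)) (Set.Ici 0) t

/-- Orbital stability of the set `Γ` for the system `v' = Y v` on `V`,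
with respect to perturbations (initial conditions) in `S`. -/
def OrbitallyStable {E : Type*} [NormedAddCommGroup E] [NormedSpace ℝ E]
    (Y : E → E) (V S Γ : Set E) : Prop :=
  ∀ ε > 0, ∃ δ' > 0, ∀ x₀ ∈ S, Metric.infDist x₀ Γ < δ' →
    ∀ x : ℝ → E, IsForwardSolution Y V x₀ x → ∀ t ≥ (0:ℝ), Metric.infDist (x t) Γ < ε

/-- Orbital phase asymptotic stability of the periodic orbit `Γ` (traced by `γ`)
for the system `v' = Y v` on `V`, with respect to perturbations in `S`. -/
def OrbitallyPhaseAsymptoticallyStable {E : Type*} [NormedAddCommGroup E] [NormedSpace ℝ E]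
    (Y : E → E) (V S : Set E) (γ : ℝ → E) (Γ : Set E) : Prop :=
  ∃ δ > 0,
    (∀ x₀ ∈ S, Metric.infDist x₀ Γ < δ → ∃ x : ℝ → E, IsForwardSolution Y V x₀ x) ∧
    (∀ ε > 0, ∃ δ' > 0, δ' ≤ δ ∧ ∀ x₀ ∈ S, Metric.infDist x₀ Γ < δ' →
      ∀ x : ℝ → E, IsForwardSolution Y V x₀ x → ∀ t ≥ (0:ℝ), Metric.infDist (x t) Γ < ε) ∧
    (∀ x₀ ∈ S, Metric.infDist x₀ Γ < δ → ∀ x : ℝ → E, IsForwardSolution Y V x₀ x →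
      Filter.Tendsto (fun t => Metric.infDist (x t) Γ) Filter.atTop (nhds 0) ∧
      ∃ θ₀ : ℝ, Filter.Tendsto (fun t => dist (x t) (γ (t + θ₀))) Filter.atTop (nhds 0))

open Filter Topology Set Metric
open scoped Manifold

/-- A compactly supported `C¹` vector field has global integral curves. -/
theorem exists_global_solution {E : Type*} [NormedAddCommGroup E] [NormedSpace ℝ E]
    [FiniteDimensional ℝ E] {Z : E → E} (hZ : ContDiff ℝ 1 Z) (hc : HasCompactSupport Z) (x₀ : E) :
    ∃ x : ℝ → E, x 0 = x₀ ∧ ∀ t, HasDerivAt x (Z (x t)) t := by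
  obtain ⟨K, hK⟩ := hZ.lipschitzWith_of_hasCompactSupport hc one_ne_zero
  obtain ⟨B, hB⟩ := hc.exists_bound_of_continuous hZ.continuous
  have hB0 : 0 ≤ B := (norm_nonneg _).trans (hB x₀)
  have hloc : ∀ y : E, ∃ x : ℝ → E, x 0 = y ∧
      ∀ t ∈ Icc (-1 : ℝ) 1, HasDerivWithinAt x (Z (x t)) (Icc (-1) 1) t := fun y ↦
    IsPicardLindelof.exists_eq_forall_mem_Icc_hasDerivWithinAt₀ (f := fun _ ↦ Z)
      (t₀ := ⟨0, by norm_num⟩) (a := ⟨B, hB0⟩) (L := ⟨B, hB0⟩) (K := K)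
      ⟨fun _ _ ↦ hK.lipschitzOnWith, fun _ _ ↦ continuousOn_const, fun _ _ _ _ ↦ hB _, by simp⟩
  obtain ⟨x, hx0, hx⟩ := exists_isMIntegralCurve_of_isMIntegralCurveOn (I := 𝓘(ℝ, E)) (M := E)
    (v := Z) (contMDiff_vectorSpace_iff_contDiff.2 hZ) one_pos
    (fun y ↦ by
      obtain ⟨x, hx0, hx⟩ := hloc y
      refine ⟨x, hx0, fun t ht ↦ ?_⟩
      have := ((hx t (Ioo_subset_Icc_self ht)).mono Ioo_subset_Icc_self).hasFDerivWithinAt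
      exact hasMFDerivWithinAt_iff_hasFDerivWithinAt.2 this) x₀
  refine ⟨x, hx0, fun t ↦ ?_⟩
  have : HasFDerivAt x ((1 : ℝ →L[ℝ] ℝ).smulRight (Z (x t))) t :=
    hasMFDerivAt_iff_hasFDerivAt.1 (hx t)
  simpa using this.hasDerivAt

/-- A `C¹` vector field on an open set agrees near a compact subset with a compactly supported
`C¹` vector field on the whole space. -/
theorem exists_compactlySupported_eventuallyEq {E : Type*} [NormedAddCommGroup E]
    [NormedSpace ℝ E] [FiniteDimensional ℝ E] {V Γ : Set E} (hV : IsOpen V) (hΓ : IsCompact Γ)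
    (hΓV : Γ ⊆ V) {Y : E → E} (hY : ContDiffOn ℝ 1 Y V) :
    ∃ Z : E → E, ContDiff ℝ 1 Z ∧ HasCompactSupport Z ∧ ∀ᶠ u in 𝓝ˢ Γ, Z u = Y u := by
  obtain ⟨L, hL, hΓL, hLV⟩ := exists_compact_between hΓ hV hΓV
  obtain ⟨f, hf1, hf0, -⟩ := exists_contMDiffMap_one_nhds_of_subset_interior (n := 1) 𝓘(ℝ, E)
    hΓ.isClosed hΓL
  have hf : ContDiff ℝ 1 f := contMDiff_iff_contDiff.1 f.contMDiff
  refine ⟨fun u ↦ f u • Y u, contDiff_iff_contDiffAt.2 fun u ↦ ?_,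
    HasCompactSupport.intro hL fun u hu ↦ by simp [hf0 u hu], ?_⟩
  · by_cases hu : u ∈ V
    · exact hf.contDiffAt.smul (hY.contDiffAt (hV.mem_nhds hu))
    · refine contDiffAt_const (c := (0 : E)) |>.congr_of_eventuallyEq ?_
      filter_upwards [hL.isClosed.isOpen_compl.mem_nhds fun h ↦ hu (hLV h)] with v hv
      simp [hf0 v hv]
  · filter_upwards [hf1] with u hu
    simp [hu]

theorem IsCompact.exists_forall_infDist_le {E : Type*} [MetricSpace E] {Γ : Set E}
    (hΓ : IsCompact Γ) (hne : Γ.Nonempty) {P : E → Prop} (hP : ∀ᶠ u in 𝓝ˢ Γ, P u) :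
    ∃ r > 0, ∀ u, infDist u Γ ≤ r → P u := by
  obtain ⟨O, hO, hΓO, hOP⟩ := mem_nhdsSet_iff_exists.1 hP
  obtain ⟨δ, hδ, hsub⟩ := hΓ.exists_thickening_subset_open hO hΓO
  refine ⟨δ / 2, half_pos hδ, fun u hu ↦ hOP (hsub ?_)⟩
  rw [mem_thickening_iff_infDist_lt hne]
  linarith

section Lyapunov

variable {E : Type*} [NormedAddCommGroup E] [NormedSpace ℝ E]

/-- A function decaying infinitesimally at rate `k` along a trajectory decays exponentially. -/
theorem lyapunov_le_exp {Y : E → E} {G : E → ℝ} {k τ : ℝ} {x : ℝ → E}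
    (hx : ∀ t ∈ Icc 0 τ, HasDerivWithinAt x (Y (x t)) (Ici 0) t)
    (hG : ∀ t ∈ Icc 0 τ, DifferentiableAt ℝ G (x t))
    (hdecay : ∀ t ∈ Icc 0 τ, fderiv ℝ G (x t) (Y (x t)) ≤ -k * G (x t))
    {t : ℝ} (ht : t ∈ Icc 0 τ) : G (x t) ≤ Real.exp (-(k * t)) * G (x 0) := by
  have hder : ∀ s ∈ Icc 0 τ, HasDerivWithinAt (fun s ↦ Real.exp (k * s) * G (x s))
      (Real.exp (k * s) * k * G (x s) + Real.exp (k * s) * fderiv ℝ G (x s) (Y (x s)))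
      (Icc 0 τ) s := fun s hs ↦ by
    have h1 : HasDerivAt (fun s ↦ Real.exp (k * s)) (Real.exp (k * s) * k) s := by
      simpa using ((hasDerivAt_id s).const_mul k).exp
    exact h1.hasDerivWithinAt.mul
      ((hG s hs).hasFDerivAt.comp_hasDerivWithinAt s ((hx s hs).mono Icc_subset_Ici_self))
  have hanti : AntitoneOn (fun s ↦ Real.exp (k * s) * G (x s)) (Icc 0 τ) := by
    refine antitoneOn_of_hasDerivWithinAt_nonpos (convex_Icc 0 τ)
      (fun s hs ↦ (hder s hs).continuousWithinAt)
      (fun s hs ↦ (hder s (interior_subset hs)).mono interior_subset) fun s hs ↦ ?_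
    nlinarith [mul_le_mul_of_nonneg_left (hdecay s (interior_subset hs)) (Real.exp_pos (k * s)).le]
  have h := hanti (left_mem_Icc.2 (ht.1.trans ht.2)) ht ht.1
  simp only [mul_zero, Real.exp_zero, one_mul] at h
  calc G (x t) = Real.exp (-(k * t)) * (Real.exp (k * t) * G (x t)) := by
        rw [← mul_assoc, ← Real.exp_add]; simp
    _ ≤ _ := by gcongr

variable {Y : E → E} {Γ : Set E} {G : E → ℝ} {m K r : ℝ} {x : ℝ → E}

/-- Trajectories starting close to `Γ` in terms of a Lyapunov function remain close to `Γ`. -/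
theorem infDist_lt_of_lyapunov (hm : 0 < m) (hK : 0 ≤ K) (hG0 : ∀ u, 0 ≤ G u)
    (hG : ∀ u, infDist u Γ ≤ r → DifferentiableAt ℝ G u)
    (hdecay : ∀ u, infDist u Γ ≤ r → fderiv ℝ G u (Y u) ≤ -(2 * m) * G u)
    (hlow : ∀ u, infDist u Γ ≤ r → infDist u Γ ≤ K * √(G u))
    (hxc : ContinuousOn x (Ici 0))
    (hx : ∀ t, 0 ≤ t → infDist (x t) Γ ≤ r → HasDerivWithinAt x (Y (x t)) (Ici 0) t)
    {ε : ℝ} (hεr : ε ≤ r) (h0 : infDist (x 0) Γ < ε) (hG0ε : K * √(G (x 0)) < ε)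
    {t : ℝ} (ht : 0 ≤ t) : infDist (x t) Γ < ε := by
  by_contra! hcon
  have hd : ContinuousOn (fun s ↦ infDist (x s) Γ) (Icc 0 t) :=
    (continuous_infDist_pt Γ).comp_continuousOn (hxc.mono Icc_subset_Ici_self)
  have hcomp : IsCompact (Icc 0 t ∩ (fun s ↦ infDist (x s) Γ) ⁻¹' Ici ε) :=
    isCompact_Icc.of_isClosed_subset (hd.preimage_isClosed_of_isClosed isClosed_Icc isClosed_Ici)
      inter_subset_left
  obtain ⟨τ, ⟨hτ, hτε⟩, hmin⟩ := hcomp.exists_isLeast ⟨t, ⟨ht, le_rfl⟩, hcon⟩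
  have hlt : ∀ s ∈ Ico 0 τ, infDist (x s) Γ < ε := fun s hs ↦ by
    by_contra! h
    exact absurd (hmin ⟨⟨hs.1, hs.2.le.trans hτ.2⟩, h⟩) hs.2.not_ge
  have hτ0 : 0 < τ := hτ.1.lt_of_ne fun h ↦ by
    rw [← h] at hτε
    exact (not_le.2 h0) hτε
  have hle : ∀ s ∈ Icc 0 τ, infDist (x s) Γ ≤ ε := by
    have hcl : closure (Ico 0 τ) = Icc 0 τ := closure_Ico hτ0.ne
    rw [← hcl]
    exact fun s hs ↦ le_on_closure (fun u hu ↦ (hlt u hu).le)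
      (hd.mono (by rw [hcl]; exact Icc_subset_Icc_right hτ.2)) continuousOn_const hs
  have hr : ∀ s ∈ Icc 0 τ, infDist (x s) Γ ≤ r := fun s hs ↦ (hle s hs).trans hεr
  have hGle : G (x τ) ≤ G (x 0) := by
    refine (lyapunov_le_exp (fun s hs ↦ hx s hs.1 (hr s hs)) (fun s hs ↦ hG _ (hr s hs))
      (fun s hs ↦ hdecay _ (hr s hs)) ⟨hτ0.le, le_rfl⟩).trans
      (mul_le_of_le_one_left (hG0 _) (Real.exp_le_one_iff.2 ?_))
    have := mul_pos hm hτ0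
    linarith
  have hτr := hlow _ (hr τ ⟨hτ0.le, le_rfl⟩)
  have : K * √(G (x τ)) ≤ K * √(G (x 0)) := by gcongr
  exact absurd (hτr.trans this) (not_le.2 (hG0ε.trans_le hτε))

/-- Trajectories staying close to `Γ` converge to `Γ` exponentially. -/
theorem infDist_le_exp_of_lyapunov (hK : 0 ≤ K)
    (hG : ∀ u, infDist u Γ ≤ r → DifferentiableAt ℝ G u)
    (hdecay : ∀ u, infDist u Γ ≤ r → fderiv ℝ G u (Y u) ≤ -(2 * m) * G u)
    (hlow : ∀ u, infDist u Γ ≤ r → infDist u Γ ≤ K * √(G u))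
    (hx : ∀ t, 0 ≤ t → HasDerivWithinAt x (Y (x t)) (Ici 0) t)
    (hr : ∀ t, 0 ≤ t → infDist (x t) Γ ≤ r) {t : ℝ} (ht : 0 ≤ t) :
    infDist (x t) Γ ≤ K * √(G (x 0)) * Real.exp (-(m * t)) := by
  have hGt : G (x t) ≤ Real.exp (-(2 * m * t)) * G (x 0) :=
    lyapunov_le_exp (τ := t) (fun s hs ↦ hx s hs.1) (fun s hs ↦ hG _ (hr s hs.1))
      (fun s hs ↦ hdecay _ (hr s hs.1)) ⟨ht, le_rfl⟩
  have hsq : Real.exp (-(2 * m * t)) = Real.exp (-(m * t)) ^ 2 := by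
    rw [← Real.exp_nat_mul]; congr 1; push_cast; ring
  calc infDist (x t) Γ ≤ K * √(G (x t)) := hlow _ (hr t ht)
    _ ≤ K * √(Real.exp (-(m * t)) ^ 2 * G (x 0)) := by rw [← hsq]; gcongr
    _ = _ := by
      rw [Real.sqrt_mul (sq_nonneg _), Real.sqrt_sq (Real.exp_pos _).le]; ring

end Lyapunov

section Phase

variable {E : Type*} [NormedAddCommGroup E] [NormedSpace ℝ E] {Z : E → E} {L : NNReal}

theorem dist_le_mul_exp_of_lipschitzWith (hZ : LipschitzWith L Z) {x y : ℝ → E}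
    (hx : ∀ t, 0 ≤ t → HasDerivWithinAt x (Z (x t)) (Ici 0) t)
    (hy : ∀ t, 0 ≤ t → HasDerivWithinAt y (Z (y t)) (Ici 0) t)
    {a t d : ℝ} (ha : 0 ≤ a) (hat : a ≤ t) (htd : t ≤ a + d) :
    dist (x t) (y t) ≤ dist (x a) (y a) * Real.exp (L * d) := by
  have hsub : Icc a t ⊆ Ici 0 := fun s hs ↦ ha.trans hs.1
  refine (dist_le_of_trajectories_ODE (v := fun _ ↦ Z) (fun _ ↦ hZ)
    (fun s hs ↦ (hx s (hsub hs)).continuousWithinAt.mono hsub)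
    (fun s hs ↦ (hx s (ha.trans hs.1)).mono (Ici_subset_Ici.2 (ha.trans hs.1)))
    (fun s hs ↦ (hy s (hsub hs)).continuousWithinAt.mono hsub)
    (fun s hs ↦ (hy s (ha.trans hs.1)).mono (Ici_subset_Ici.2 (ha.trans hs.1)))
    le_rfl t ⟨hat, le_rfl⟩).trans ?_
  gcongr
  linarith

variable {γ : ℝ → E} {T : ℝ}

theorem hasDerivWithinAt_comp_const_add (hγ : ∀ t, HasDerivAt γ (Z (γ t)) t) (a : ℝ) (s : Set ℝ)
    (t : ℝ) : HasDerivWithinAt (fun t ↦ γ (a + t)) (Z (γ (a + t))) s t :=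
  ((hγ (a + t)).comp_const_add a t).hasDerivWithinAt

/-- The flow along a periodic orbit is uniformly Lipschitz. -/
theorem dist_periodic_orbit_add_le (hZ : LipschitzWith L Z) (hT : 0 < T)
    (hγ : ∀ t, HasDerivAt γ (Z (γ t)) t) (hper : Function.Periodic γ T) (a b t : ℝ) :
    dist (γ (a + t)) (γ (b + t)) ≤ dist (γ a) (γ b) * Real.exp (L * T) := by
  have hmod : ∀ c, γ (c + t) = γ (c + toIcoMod hT 0 t) := fun c ↦ by
    rw [toIcoMod, ← add_sub_assoc, hper.sub_zsmul_eq]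
  have hmem := toIcoMod_mem_Ico hT 0 t
  rw [hmod a, hmod b]
  simpa using dist_le_mul_exp_of_lipschitzWith hZ
    (fun t _ ↦ hasDerivWithinAt_comp_const_add hγ a _ t)
    (fun t _ ↦ hasDerivWithinAt_comp_const_add hγ b _ t) le_rfl hmem.1 hmem.2.le

/-- A trajectory converging exponentially to a periodic orbit has an asymptotic phase. -/
theorem exists_asymptotic_phase (hZ : LipschitzWith L Z) (hT : 0 < T)
    (hγ : ∀ t, HasDerivAt γ (Z (γ t)) t) (hper : Function.Periodic γ T) {x : ℝ → E}
    (hx : ∀ t, 0 ≤ t → HasDerivWithinAt x (Z (x t)) (Ici 0) t) {A m : ℝ} (hm : 0 < m)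
    (hd : ∀ t, 0 ≤ t → infDist (x t) (range γ) ≤ A * Real.exp (-(m * t))) :
    ∃ θ : ℝ, Tendsto (fun t ↦ dist (x t) (γ (t + θ))) atTop (𝓝 0) := by
  have hcomp := hper.compact_of_continuous hT.ne'
    (continuous_iff_continuousAt.2 fun t ↦ (hγ t).continuousAt)
  have hA : 0 ≤ A := by simpa using infDist_nonneg.trans (hd 0 le_rfl)
  have hnear : ∀ n : ℕ, ∃ s, dist (x n) (γ s) ≤ A * Real.exp (-m) ^ n := fun n ↦ by
    obtain ⟨_, ⟨s, rfl⟩, hs⟩ := hcomp.exists_infDist_eq_dist (range_nonempty γ) (x n)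
    refine ⟨s, hs ▸ (hd n n.cast_nonneg).trans_eq ?_⟩
    rw [← Real.exp_nat_mul]
    ring_nf
  choose s hs using hnear
  have hρ : Real.exp (-m) < 1 := Real.exp_lt_one_iff.2 (neg_lt_zero.2 hm)
  have hshift : ∀ (n : ℕ) (c t : ℝ), (n : ℝ) ≤ t → t ≤ n + 1 →
      dist (x t) (γ (c + t)) ≤ dist (x n) (γ (c + n)) * Real.exp L := fun n c t h1 h2 ↦ by
    simpa using dist_le_mul_exp_of_lipschitzWith hZ hx
      (fun t _ ↦ hasDerivWithinAt_comp_const_add hγ c _ t) n.cast_nonneg h1 h2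
  have hcauchy : CauchySeq fun n : ℕ ↦ γ (s n - n) := by
    refine cauchySeq_of_le_geometric (Real.exp (-m))
      ((A * Real.exp L + A) * Real.exp (L * T)) hρ fun n ↦ ?_
    have h1 := dist_periodic_orbit_add_le hZ hT hγ hper (s n + 1) (s (n + 1)) (-(n + 1))
    have h2 := hshift n (s n - n) (n + 1) (by linarith) le_rfl
    have h3 : A * Real.exp (-m) ^ (n + 1) ≤ A * Real.exp (-m) ^ n :=
      mul_le_mul_of_nonneg_left (pow_le_pow_of_le_one (Real.exp_pos _).le hρ.le n.le_succ) hA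
    have h4 := hs (n + 1)
    rw [sub_add_cancel] at h2
    push_cast at h4 ⊢
    calc dist (γ (s n - n)) (γ (s (n + 1) - (n + 1)))
        = dist (γ (s n + 1 + -(n + 1))) (γ (s (n + 1) + -(n + 1))) := by congr 2; ring
      _ ≤ dist (γ (s n + 1)) (γ (s (n + 1))) * Real.exp (L * T) := h1
      _ ≤ (dist (x (n + 1)) (γ (s n - n + (n + 1))) + dist (x (n + 1)) (γ (s (n + 1))))
            * Real.exp (L * T) := by
          gcongr
          rw [show s n - n + ((n : ℝ) + 1) = s n + 1 by ring]
          exact dist_triangle_left _ _ _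
      _ ≤ (A * Real.exp (-m) ^ n * Real.exp L + A * Real.exp (-m) ^ n) * Real.exp (L * T) := by
          gcongr
          · exact h2.trans (mul_le_mul_of_nonneg_right (hs n) (Real.exp_pos _).le)
          · exact h4.trans h3
      _ = _ := by ring
  obtain ⟨_, ⟨θ, rfl⟩, hθ⟩ :=
    cauchySeq_tendsto_of_isComplete hcomp.isComplete (fun n ↦ mem_range_self _) hcauchy
  refine ⟨θ, ?_⟩
  have hlim : Tendsto (fun n : ℕ ↦ (A * Real.exp (-m) ^ n
      + dist (γ (s n - n)) (γ θ) * Real.exp (L * T)) * Real.exp L) atTop (𝓝 0) := by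
    have h1 := (tendsto_pow_atTop_nhds_zero_of_lt_one (Real.exp_pos _).le hρ).const_mul A
    have h2 := (tendsto_iff_dist_tendsto_zero.1 hθ).mul_const (Real.exp (L * T))
    simpa using (h1.add h2).mul_const (Real.exp L)
  refine squeeze_zero' (.of_forall fun _ ↦ dist_nonneg) ?_
    (hlim.comp (tendsto_nat_floor_atTop (α := ℝ)))
  filter_upwards [eventually_ge_atTop 0] with t ht
  have h1 := hshift ⌊t⌋₊ θ t (Nat.floor_le ht) (Nat.lt_floor_add_one t).le
  have h2 := dist_periodic_orbit_add_le hZ hT hγ hper (s ⌊t⌋₊ - ⌊t⌋₊) θ ⌊t⌋₊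
  rw [sub_add_cancel] at h2
  rw [add_comm t θ]
  refine h1.trans (mul_le_mul_of_nonneg_right ?_ (Real.exp_pos _).le)
  exact (dist_triangle _ _ _).trans (add_le_add (hs _) h2)

end Phase

/-- A periodic orbit whose distance is controlled by an exponentially decaying Lyapunov function
is orbitally phase asymptotically stable. -/
theorem orbitallyPhaseAsymptoticallyStable_of_lyapunov {E : Type*} [NormedAddCommGroup E]
    [NormedSpace ℝ E] [FiniteDimensional ℝ E] {V : Set E} (hV : IsOpen V) {Y : E → E}
    (hY : ContDiffOn ℝ 1 Y V) {γ : ℝ → E} {T : ℝ} (hT : 0 < T) (hγV : ∀ t, γ t ∈ V)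
    (hγ : ∀ t, HasDerivAt γ (Y (γ t)) t) (hper : Function.Periodic γ T) {G : E → ℝ}
    (hG : DifferentiableOn ℝ G V) (hG0 : ∀ u, 0 ≤ G u) (hGγ : ∀ t, G (γ t) = 0) {m K : ℝ}
    (hm : 0 < m) (hK : 0 ≤ K)
    (hdecay : ∀ᶠ u in 𝓝ˢ (range γ), fderiv ℝ G u (Y u) ≤ -(2 * m) * G u)
    (hlow : ∀ᶠ u in 𝓝ˢ (range γ), infDist u (range γ) ≤ K * √(G u)) :
    OrbitallyPhaseAsymptoticallyStable Y V V γ (range γ) := by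
  have hcomp := hper.compact_of_continuous hT.ne'
    (continuous_iff_continuousAt.2 fun t ↦ (hγ t).continuousAt)
  have hne := range_nonempty γ
  have hΓV : range γ ⊆ V := range_subset_iff.2 hγV
  obtain ⟨Z, hZ, hZc, hZY⟩ := exists_compactlySupported_eventuallyEq hV hcomp hΓV hY
  obtain ⟨L, hL⟩ := hZ.lipschitzWith_of_hasCompactSupport hZc one_ne_zero
  obtain ⟨r, hr, hN⟩ := hcomp.exists_forall_infDist_le hne
    (((hdecay.and hlow).and hZY).and (hV.mem_nhdsSet.2 hΓV))
  have hNG : ∀ u, infDist u (range γ) ≤ r → DifferentiableAt ℝ G u :=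
    fun u hu ↦ hG.differentiableAt (hV.mem_nhds (hN u hu).2)
  have hNd : ∀ u, infDist u (range γ) ≤ r → fderiv ℝ G u (Y u) ≤ -(2 * m) * G u :=
    fun u hu ↦ (hN u hu).1.1.1
  have hNl : ∀ u, infDist u (range γ) ≤ r → infDist u (range γ) ≤ K * √(G u) :=
    fun u hu ↦ (hN u hu).1.1.2
  have hNZ : ∀ u, infDist u (range γ) ≤ r → Z u = Y u := fun u hu ↦ (hN u hu).1.2
  have hγZ : ∀ t, HasDerivAt γ (Z (γ t)) t := fun t ↦ by
    rw [hNZ _ (by rw [infDist_zero_of_mem (mem_range_self t)]; exact hr.le)]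
    exact hγ t
  have hstab : ∀ ε > 0, ε ≤ r → ∃ δ > 0, δ ≤ r ∧ ∀ x : ℝ → E, infDist (x 0) (range γ) < δ →
      ContinuousOn x (Ici 0) → (∀ t, 0 ≤ t → infDist (x t) (range γ) ≤ r →
        HasDerivWithinAt x (Y (x t)) (Ici 0) t) →
      ∀ t, 0 ≤ t → infDist (x t) (range γ) < ε := by
    intro ε hε hεr
    have hev : ∀ᶠ u in 𝓝ˢ (range γ), K * √(G u) < ε := by
      refine eventually_nhdsSet_iff_forall.2 ?_
      rintro _ ⟨t, rfl⟩
      have hc : ContinuousAt (fun u ↦ K * √(G u)) (γ t) :=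
        (hG.differentiableAt (hV.mem_nhds (hγV t))).continuousAt.sqrt.const_mul K
      exact hc.eventually_lt continuousAt_const (by simpa [hGγ] using hε)
    obtain ⟨δ, hδ, hδε⟩ := hcomp.exists_forall_infDist_le hne hev
    refine ⟨min δ ε, lt_min hδ hε, (min_le_right _ _).trans hεr, fun x h0 hxc hx t ht ↦ ?_⟩
    exact infDist_lt_of_lyapunov hm hK hG0 hNG hNd hNl hxc hx hεr (h0.trans_le (min_le_right _ _))
      (hδε _ (h0.le.trans (min_le_left _ _))) ht
  have hforward : ∀ {x₀ x}, IsForwardSolution Y V x₀ x → ContinuousOn x (Ici 0) :=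
    fun hx t ht ↦ (hx.2 t ht).2.continuousWithinAt
  obtain ⟨δ, hδ, hδr, hδstab⟩ := hstab r hr le_rfl
  refine ⟨δ, hδ, fun x₀ _ h0 ↦ ?_, fun ε hε ↦ ?_, fun x₀ _ h0 x hx ↦ ?_⟩
  · obtain ⟨x, hx0, hx⟩ := exists_global_solution hZ hZc x₀
    have hxr := hδstab x (by rwa [hx0])
      (fun t _ ↦ (hx t).continuousAt.continuousWithinAt)
      (fun t _ htr ↦ by rw [← hNZ _ htr]; exact (hx t).hasDerivWithinAt)
    refine ⟨x, hx0, fun t ht ↦ ⟨(hN _ (hxr t ht).le).2, ?_⟩⟩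
    rw [← hNZ _ (hxr t ht).le]
    exact (hx t).hasDerivWithinAt
  · obtain ⟨δ', hδ', -, h⟩ := hstab (min ε r) (lt_min hε hr) (min_le_right _ _)
    refine ⟨min δ' δ, lt_min hδ' hδ, min_le_right _ _, fun x₀ _ h0 x hx t ht ↦ ?_⟩
    exact (h x (by rw [hx.1]; exact h0.trans_le (min_le_left _ _)) (hforward hx)
      (fun t ht _ ↦ (hx.2 t ht).2) t ht).trans_le (min_le_left _ _)
  · have hxr : ∀ t, 0 ≤ t → infDist (x t) (range γ) ≤ r := fun t ht ↦
      (hδstab x (by rwa [hx.1]) (hforward hx) (fun t ht _ ↦ (hx.2 t ht).2) t ht).le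
    have hexp : ∀ t, 0 ≤ t → infDist (x t) (range γ) ≤ K * √(G (x 0)) * Real.exp (-(m * t)) :=
      fun t ht ↦ infDist_le_exp_of_lyapunov hK hNG hNd hNl (fun t ht ↦ (hx.2 t ht).2) hxr ht
    refine ⟨squeeze_zero' (.of_forall fun _ ↦ infDist_nonneg)
      ((eventually_ge_atTop 0).mono hexp) ?_, ?_⟩
    · have : Tendsto (fun t : ℝ ↦ Real.exp (-(m * t))) atTop (𝓝 0) :=
        Real.tendsto_exp_neg_atTop_nhds_zero.comp (tendsto_id.const_mul_atTop hm)
      simpa using this.const_mul (K * √(G (x 0)))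
    · exact exists_asymptotic_phase hL hT hγZ hper
        (fun t ht ↦ by rw [hNZ _ (hxr t ht)]; exact (hx.2 t ht).2) hm hexp

/-- A nonconstant integral curve of a `C¹` vector field contains no equilibrium, provided that its
image is compact. -/
theorem vectorField_ne_zero_of_nonconstant {E : Type*} [NormedAddCommGroup E]
    [NormedSpace ℝ E] [FiniteDimensional ℝ E] {V : Set E} (hV : IsOpen V) {Y : E → E}
    (hY : ContDiffOn ℝ 1 Y V) {γ : ℝ → E} (hγV : ∀ t, γ t ∈ V) (hcomp : IsCompact (range γ))
    (hγ : ∀ t, HasDerivAt γ (Y (γ t)) t) (hne : ∃ s t, γ s ≠ γ t) (t₀ : ℝ) : Y (γ t₀) ≠ 0 := by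
  intro h0
  obtain ⟨Z, hZ, hZc, hZY⟩ :=
    exists_compactlySupported_eventuallyEq hV hcomp (range_subset_iff.2 hγV) hY
  obtain ⟨L, hL⟩ := hZ.lipschitzWith_of_hasCompactSupport hZc one_ne_zero
  have hZγ : ∀ t, Z (γ t) = Y (γ t) := fun t ↦
    (eventually_nhdsSet_iff_forall.1 hZY _ (mem_range_self t)).self_of_nhds
  have heq : γ = fun _ ↦ γ t₀ :=
    ODE_solution_unique_univ (v := fun _ ↦ Z) (s := fun _ ↦ univ) (t₀ := t₀)
      (fun _ ↦ hL.lipschitzOnWith) (fun t ↦ ⟨by rw [hZγ]; exact hγ t, mem_univ _⟩)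
      (fun t ↦ ⟨by rw [hZγ, h0]; exact hasDerivAt_const _ _, mem_univ _⟩) rfl
  obtain ⟨s, t, hst⟩ := hne
  exact hst (by rw [heq])

/-- Near a point of a curve on which `f` is constant, the distance to the curve is controlled
by `f`, if the derivative of `f` is injective transversally to the curve. -/
theorem exists_eventually_infDist_range_le {E F : Type*} [NormedAddCommGroup E]
    [InnerProductSpace ℝ E] [FiniteDimensional ℝ E] [NormedAddCommGroup F] [NormedSpace ℝ F]
    {f : E → F} {f' : E →L[ℝ] F} {γ : ℝ → E} {v : E} {t₀ : ℝ} {q : F}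
    (hf : HasStrictFDerivAt f f' (γ t₀)) (hγ : HasStrictDerivAt γ v t₀) (hv : v ≠ 0)
    (hfγ : ∀ t, f (γ t) = q) (hinj : ∀ w, f' w = 0 → inner ℝ v w = 0 → w = 0) :
    ∃ K ≥ 0, ∀ᶠ u in 𝓝 (γ t₀), infDist u (range γ) ≤ K * ‖f u - q‖ := by
  let g' : E →L[ℝ] F × ℝ := f'.prod (innerSL ℝ v)
  have hg : HasStrictFDerivAt (fun u ↦ (f u, innerSL ℝ v u)) g' (γ t₀) :=
    hf.prodMk (innerSL ℝ v).hasStrictFDerivAt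
  obtain ⟨k, hk, hanti⟩ := g'.toLinearMap.exists_antilipschitzWith <|
    LinearMap.ker_eq_bot'.2 fun w hw ↦ hinj w (congrArg Prod.fst hw) (congrArg Prod.snd hw)
  obtain ⟨W, hW, happ⟩ := hg.approximates_deriv_on_nhds (c := (2 * k)⁻¹) (Or.inr (by positivity))
  refine ⟨2 * k, by positivity, ?_⟩
  have hφ : HasStrictDerivAt (fun t ↦ innerSL ℝ v (γ t)) (innerSL ℝ v v) t₀ :=
    (innerSL ℝ v).hasStrictFDerivAt.comp_hasStrictDerivAt t₀ hγ
  have hφ0 : innerSL ℝ v v ≠ 0 := by simpa using hv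
  have himg : (fun t ↦ innerSL ℝ v (γ t)) '' (γ ⁻¹' W) ∈ 𝓝 (innerSL ℝ v (γ t₀)) := by
    rw [← hφ.map_nhds_eq hφ0]
    exact image_mem_map (hγ.hasDerivAt.continuousAt hW)
  filter_upwards [hW, (innerSL ℝ v).continuous.continuousAt himg] with u hu hut
  obtain ⟨t, ht, htu : innerSL ℝ v (γ t) = innerSL ℝ v u⟩ := hut
  have h1 : ‖u - γ t‖ ≤ k * ‖g' (u - γ t)‖ := by
    simpa using hanti.le_mul_dist (u - γ t) 0
  have h2 := happ u hu (γ t) ht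
  have h3 : ‖((f u, innerSL ℝ v u) : F × ℝ) - (f (γ t), innerSL ℝ v (γ t))‖ = ‖f u - q‖ := by
    rw [Prod.mk_sub_mk, htu, sub_self, hfγ, Prod.norm_mk, norm_zero, max_eq_left (norm_nonneg _)]
  have h4 := norm_sub_norm_le (g' (u - γ t))
    (((f u, innerSL ℝ v u) : F × ℝ) - (f (γ t), innerSL ℝ v (γ t)))
  rw [norm_sub_rev (g' _), h3] at h4
  push_cast at h2
  have h5 : k * ‖g' (u - γ t)‖ ≤ k * ‖f u - q‖ + ‖u - γ t‖ / 2 := by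
    have hk' : (k : ℝ) ≠ 0 := by positivity
    calc k * ‖g' (u - γ t)‖ ≤ k * (‖f u - q‖ + (2 * k : ℝ)⁻¹ * ‖u - γ t‖) := by
          gcongr; linarith
      _ = _ := by field_simp
  calc infDist u (range γ) ≤ dist u (γ t) := infDist_le_dist_of_mem (mem_range_self t)
    _ = ‖u - γ t‖ := dist_eq_norm _ _
    _ ≤ _ := by linarith

/-- Local linear bounds around the points of a compact set yield a bound around the set. -/
theorem IsCompact.exists_eventually_nhdsSet_le_mul {α : Type*} [TopologicalSpace α] {s : Set α}
    (hs : IsCompact s) {f g : α → ℝ} (hg : ∀ u, 0 ≤ g u)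
    (h : ∀ x ∈ s, ∃ K ≥ 0, ∀ᶠ u in 𝓝 x, f u ≤ K * g u) :
    ∃ K ≥ 0, ∀ᶠ u in 𝓝ˢ s, f u ≤ K * g u := by
  refine hs.induction_on (p := fun s ↦ ∃ K ≥ 0, ∀ᶠ u in 𝓝ˢ s, f u ≤ K * g u)
    ⟨0, le_rfl, by simp⟩ (fun s t hst ⟨K, hK, h⟩ ↦ ⟨K, hK, h.filter_mono (nhdsSet_mono hst)⟩)
    (fun s t ⟨K, hK, h⟩ ⟨K', hK', h'⟩ ↦ ⟨max K K', hK.trans (le_max_left _ _), ?_⟩)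
    (fun x hx ↦ ?_)
  · rw [nhdsSet_union, eventually_sup]
    exact ⟨h.mono fun u hu ↦ hu.trans (mul_le_mul_of_nonneg_right (le_max_left _ _) (hg u)),
      h'.mono fun u hu ↦ hu.trans (mul_le_mul_of_nonneg_right (le_max_right _ _) (hg u))⟩
  · obtain ⟨K, hK, h⟩ := h x hx
    exact ⟨_, mem_nhdsWithin_of_mem_nhds (eventually_eventually_nhds.2 h), K, hK,
      eventually_nhdsSet_iff_forall.2 fun _ hy ↦ hy⟩

section CrossProduct

theorem inner_left_cross3 (a b : E3) : inner ℝ a (cross3 a b) = 0 := by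
  simp [cross3, crossProduct, PiLp.inner_apply, Fin.sum_univ_three]
  ring

theorem inner_right_cross3 (a b : E3) : inner ℝ b (cross3 a b) = 0 := by
  simp [cross3, crossProduct, PiLp.inner_apply, Fin.sum_univ_three]
  ring

theorem inner_cross3_cross3_right (a b : E3) :
    inner ℝ a (cross3 b (cross3 a b)) = ‖cross3 a b‖ ^ 2 := by
  simp [cross3, crossProduct, PiLp.inner_apply, Fin.sum_univ_three, EuclideanSpace.norm_sq_eq]
  ring

theorem inner_cross3_cross3_left (a b : E3) :
    inner ℝ b (cross3 a (cross3 a b)) = -‖cross3 a b‖ ^ 2 := by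
  simp [cross3, crossProduct, PiLp.inner_apply, Fin.sum_univ_three, EuclideanSpace.norm_sq_eq]
  ring

theorem norm_sq_mul_norm_cross3_sq (a b v : E3) : ‖v‖ ^ 2 * ‖cross3 a b‖ ^ 2 =
    inner ℝ (cross3 a b) v ^ 2 + ‖inner ℝ b v • a - inner ℝ a v • b‖ ^ 2 := by
  simp [cross3, crossProduct, PiLp.inner_apply, Fin.sum_univ_three, EuclideanSpace.norm_sq_eq]
  ring

theorem cross3_ne_zero {a b : E3} (h : LinearIndependent ℝ ![a, b]) : cross3 a b ≠ 0 := by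
  have hmap := h.map' (WithLp.linearEquiv 2 ℝ (Fin 3 → ℝ)).toLinearMap (LinearEquiv.ker _)
  have hv : (WithLp.linearEquiv 2 ℝ (Fin 3 → ℝ)).toLinearMap ∘ ![a, b]
      = ![WithLp.equiv 2 _ a, WithLp.equiv 2 _ b] := by
    ext i; fin_cases i <;> rfl
  rw [hv] at hmap
  intro h0
  exact crossProduct_ne_zero_iff_linearIndependent.2 hmap
    ((WithLp.equiv 2 (Fin 3 → ℝ)).symm.injective h0)

/-- A vector orthogonal to two independent vectors and to their cross product vanishes. -/
theorem eq_zero_of_inner_cross3_eq_zero {a b v : E3} (h : cross3 a b ≠ 0)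
    (ha : inner ℝ a v = 0) (hb : inner ℝ b v = 0) (hab : inner ℝ (cross3 a b) v = 0) :
    v = 0 := by
  have := norm_sq_mul_norm_cross3_sq a b v
  simpa [ha, hb, hab, h] using this

theorem ContDiffOn.cross3 {n : WithTop ℕ∞} {V : Set E3} {f g : E3 → E3}
    (hf : ContDiffOn ℝ n f V) (hg : ContDiffOn ℝ n g V) :
    ContDiffOn ℝ n (fun u ↦ cross3 (f u) (g u)) V := by
  rw [contDiffOn_euclidean] at *
  intro i
  fin_cases i
  · exact ((hf 1).mul (hg 2)).sub ((hf 2).mul (hg 1))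
  · exact ((hf 2).mul (hg 0)).sub ((hf 0).mul (hg 2))
  · exact ((hf 0).mul (hg 1)).sub ((hf 1).mul (hg 0))

end CrossProduct

theorem ContDiffOn.gradient {E : Type*} [NormedAddCommGroup E] [InnerProductSpace ℝ E]
    [CompleteSpace E] {m n : WithTop ℕ∞} {V : Set E} (hV : IsOpen V) {f : E → ℝ}
    (hf : ContDiffOn ℝ n f V) (hmn : m + 1 ≤ n) : ContDiffOn ℝ m (gradient f) V :=
  (InnerProductSpace.toDual ℝ E).symm.contDiff.comp_contDiffOn (hf.fderiv_of_isOpen hV hmn)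

/-- For every pair of smooth functions `α, β : V → (0,∞)`, `Γ` is a
periodic orbit of the perturbed system
`v' = X(v) − α(v)(H(v)−h)[∇C(v) × (∇H(v) × ∇C(v))] + β(v)(C(v)−c)[∇H(v) × (∇H(v) × ∇C(v))]`
and is orbitally phase asymptotically stable with respect to perturbations in `V`. -/
theorem stmt_10
    (U : Set E3) (hU : IsOpen U) (ν H C : E3 → ℝ)
    (hν : ContDiffOn ℝ (⊤ : ℕ∞) ν U) (hH : ContDiffOn ℝ (⊤ : ℕ∞) H U)
    (hC : ContDiffOn ℝ (⊤ : ℕ∞) C U)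
    (X : E3 → E3) (hX : ∀ u, X u = ν u • cross3 (gradient H u) (gradient C u))
    (V : Set E3) (hV : IsOpen V) (hVU : V ⊆ U)
    (hind : ∀ u ∈ V, LinearIndependent ℝ ![gradient H u, gradient C u])
    (γ : ℝ → E3) (T : ℝ) (hT : 0 < T)
    (hγV : ∀ t, γ t ∈ V)
    (hsol : ∀ t, HasDerivAt γ (X (γ t)) t)
    (hper : ∀ t, γ (t + T) = γ t)
    (hnonconst : ∃ s t, γ s ≠ γ t)
    (Γ : Set E3) (hΓ : Γ = γ '' Set.Icc 0 T)
    (h c : ℝ) (hHγ : ∀ t, H (γ t) = h) (hCγ : ∀ t, C (γ t) = c)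
    (hreg : ∀ u ∈ U, H u = h → C u = c →
      LinearIndependent ℝ ![gradient H u, gradient C u])
    (α β : E3 → ℝ)
    (hα : ContDiffOn ℝ (⊤ : ℕ∞) α V) (hαpos : ∀ u ∈ V, 0 < α u)
    (hβ : ContDiffOn ℝ (⊤ : ℕ∞) β V) (hβpos : ∀ u ∈ V, 0 < β u)
    (Y : E3 → E3)
    (hY : ∀ u, Y u = X u
      - (α u * (H u - h)) • cross3 (gradient C u) (cross3 (gradient H u) (gradient C u))
      + (β u * (C u - c)) • cross3 (gradient H u) (cross3 (gradient H u) (gradient C u))) :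
    (∀ t, HasDerivAt γ (Y (γ t)) t) ∧
      OrbitallyPhaseAsymptoticallyStable Y V V γ Γ := by
  have hHV := hH.mono hVU
  have hCV := hC.mono hVU
  have hgH : ContDiffOn ℝ 1 (gradient H) V := hHV.gradient hV (by norm_cast)
  have hgC : ContDiffOn ℝ 1 (gradient C) V := hCV.gradient hV (by norm_cast)
  have h1top : (1 : WithTop ℕ∞) ≤ ((⊤ : ℕ∞) : WithTop ℕ∞) := by norm_cast
  have hHd : ∀ u ∈ V, ContDiffAt ℝ 1 H u := fun u hu ↦
    (hHV.of_le h1top).contDiffAt (hV.mem_nhds hu)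
  have hCd : ∀ u ∈ V, ContDiffAt ℝ 1 C u := fun u hu ↦
    (hCV.of_le h1top).contDiffAt (hV.mem_nhds hu)
  have hN : ∀ u ∈ V, cross3 (gradient H u) (gradient C u) ≠ 0 := fun u hu ↦
    cross3_ne_zero (hind u hu)
  have hNc : ContDiffOn ℝ 1 (fun u ↦ cross3 (gradient H u) (gradient C u)) V := hgH.cross3 hgC
  have hYV : ContDiffOn ℝ 1 Y V := by
    have hα1 := hα.of_le h1top
    have hβ1 := hβ.of_le h1top
    have hν1 := (hν.mono hVU).of_le h1top
    have hH1 := hHV.of_le h1top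
    have hC1 := hCV.of_le h1top
    refine ContDiffOn.congr ?_ fun u _ ↦ (hY u).trans (by rw [hX u])
    exact ((hν1.smul hNc).sub ((hα1.mul (hH1.sub contDiffOn_const)).smul (hgC.cross3 hNc))).add
      ((hβ1.mul (hC1.sub contDiffOn_const)).smul (hgH.cross3 hNc))
  have hYX : ∀ t, Y (γ t) = X (γ t) := fun t ↦ by simp [hY, hHγ, hCγ]
  have hγ : ∀ t, HasDerivAt γ (Y (γ t)) t := fun t ↦ by rw [hYX]; exact hsol t
  have hΓrange : Γ = range γ := by
    rw [hΓ, ← Function.Periodic.image_Icc hper hT 0, zero_add]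
  have hcont : Continuous γ := continuous_iff_continuousAt.2 fun t ↦ (hγ t).continuousAt
  have hcomp : IsCompact (range γ) := Function.Periodic.compact_of_continuous hper hT.ne' hcont
  have hY0 := vectorField_ne_zero_of_nonconstant hV hYV hγV hcomp hγ hnonconst
  have hgradH : ∀ u ∈ V, ∀ w, fderiv ℝ H u w = inner ℝ (gradient H u) w := fun u _ w ↦ by
    simp [gradient]
  have hgradC : ∀ u ∈ V, ∀ w, fderiv ℝ C u w = inner ℝ (gradient C u) w := fun u _ w ↦ by
    simp [gradient]
  refine ⟨hγ, ?_⟩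
  rw [hΓrange]
  obtain ⟨K, hK, hlow⟩ : ∃ K ≥ 0, ∀ᶠ u in 𝓝ˢ (range γ),
      infDist u (range γ) ≤ K * √((H u - h) ^ 2 + (C u - c) ^ 2) := by
    refine hcomp.exists_eventually_nhdsSet_le_mul (fun u ↦ Real.sqrt_nonneg _) ?_
    rintro _ ⟨t₀, rfl⟩
    have hγs : HasStrictDerivAt γ (Y (γ t₀)) t₀ :=
      hasStrictDerivAt_of_hasDerivAt_of_continuousAt (f' := fun t ↦ Y (γ t)) (.of_forall hγ)
        ((hYV.continuousOn.continuousAt (hV.mem_nhds (hγV t₀))).comp hcont.continuousAt)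
    have hF := ((hHd _ (hγV t₀)).hasStrictFDerivAt one_ne_zero).prodMk
      ((hCd _ (hγV t₀)).hasStrictFDerivAt one_ne_zero)
    obtain ⟨K, hK, hev⟩ := exists_eventually_infDist_range_le hF hγs (hY0 t₀) (q := (h, c))
      (fun t ↦ by simp [hHγ, hCγ]) fun w hw hYw ↦ by
        have hwH : fderiv ℝ H (γ t₀) w = 0 := congrArg Prod.fst hw
        have hwC : fderiv ℝ C (γ t₀) w = 0 := congrArg Prod.snd hw
        rw [hgradH _ (hγV t₀)] at hwH
        rw [hgradC _ (hγV t₀)] at hwC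
        have hν0 : ν (γ t₀) ≠ 0 := fun h0 ↦ hY0 t₀ (by rw [hYX, hX, h0, zero_smul])
        rw [hYX, hX, real_inner_smul_left] at hYw
        exact eq_zero_of_inner_cross3_eq_zero (hN _ (hγV t₀)) hwH hwC
          ((mul_eq_zero.1 hYw).resolve_left hν0)
    refine ⟨K, hK, hev.mono fun u hu ↦ hu.trans (mul_le_mul_of_nonneg_left ?_ hK)⟩
    rw [Prod.mk_sub_mk, Prod.norm_mk, Real.norm_eq_abs, Real.norm_eq_abs]
    exact max_le (Real.abs_le_sqrt (by nlinarith [sq_nonneg (C u - c)]))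
      (Real.abs_le_sqrt (by nlinarith [sq_nonneg (H u - h)]))
  obtain ⟨m, hm, hmev⟩ : ∃ m > 0, ∀ᶠ u in 𝓝ˢ (range γ), u ∈ V ∧
      m ≤ α u * ‖cross3 (gradient H u) (gradient C u)‖ ^ 2 ∧
      m ≤ β u * ‖cross3 (gradient H u) (gradient C u)‖ ^ 2 := by
    let κ : E3 → ℝ := fun u ↦ min (α u * ‖cross3 (gradient H u) (gradient C u)‖ ^ 2)
      (β u * ‖cross3 (gradient H u) (gradient C u)‖ ^ 2)
    have hN2 := hNc.continuousOn.norm.pow 2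
    have hκ : ContinuousOn κ V := (hα.continuousOn.mul hN2).inf (hβ.continuousOn.mul hN2)
    obtain ⟨u₀, ⟨t₀, rfl⟩, hmin⟩ := hcomp.exists_isMinOn (range_nonempty γ)
      (hκ.mono (range_subset_iff.2 hγV))
    have hpos : 0 < κ (γ t₀) := by
      have := norm_pos_iff.2 (hN _ (hγV t₀))
      have hα0 := hαpos _ (hγV t₀)
      have hβ0 := hβpos _ (hγV t₀)
      exact lt_min (by positivity) (by positivity)
    refine ⟨κ (γ t₀) / 2, half_pos hpos, eventually_nhdsSet_iff_forall.2 ?_⟩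
    rintro _ ⟨t, rfl⟩
    have hlt : κ (γ t₀) / 2 < κ (γ t) := (half_lt_self hpos).trans_le (hmin (mem_range_self t))
    filter_upwards [hV.mem_nhds (hγV t),
      (hκ.continuousAt (hV.mem_nhds (hγV t))).eventually (lt_mem_nhds hlt)] with u huV hu
    exact ⟨huV, hu.le.trans (min_le_left _ _), hu.le.trans (min_le_right _ _)⟩
  have hder : ∀ u ∈ V, HasFDerivAt (fun u ↦ (H u - h) ^ 2 + (C u - c) ^ 2)
      ((2 * (H u - h)) • fderiv ℝ H u + (2 * (C u - c)) • fderiv ℝ C u) u := fun u hu ↦ by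
    have h1 := (((hHd u hu).differentiableAt one_ne_zero).hasFDerivAt.sub_const h).pow 2
    have h2 := (((hCd u hu).differentiableAt one_ne_zero).hasFDerivAt.sub_const c).pow 2
    simpa using h1.fun_add h2
  refine orbitallyPhaseAsymptoticallyStable_of_lyapunov hV hYV hT hγV hγ hper
    (G := fun u ↦ (H u - h) ^ 2 + (C u - c) ^ 2)
    (fun u hu ↦ (hder u hu).differentiableAt.differentiableWithinAt)
    (fun u ↦ by positivity) (fun t ↦ by simp [hHγ, hCγ]) hm hK (hmev.mono ?_) hlow
  rintro u ⟨huV, hmα, hmβ⟩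
  have hHY : fderiv ℝ H u (Y u) =
      -(α u * (H u - h) * ‖cross3 (gradient H u) (gradient C u)‖ ^ 2) := by
    rw [hgradH u huV, hY, hX, inner_add_right, inner_sub_right, real_inner_smul_right,
      real_inner_smul_right, real_inner_smul_right, inner_left_cross3, inner_cross3_cross3_right,
      inner_left_cross3]
    ring
  have hCY : fderiv ℝ C u (Y u) =
      -(β u * (C u - c) * ‖cross3 (gradient H u) (gradient C u)‖ ^ 2) := by
    rw [hgradC u huV, hY, hX, inner_add_right, inner_sub_right, real_inner_smul_right,
      real_inner_smul_right, real_inner_smul_right, inner_right_cross3, inner_left_cross3,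
      inner_cross3_cross3_left]
    ring
  rw [(hder u huV).fderiv, add_apply, smul_apply, smul_apply, hHY, hCY]
  simp only [smul_eq_mul]
  nlinarith [mul_le_mul_of_nonneg_right hmα (sq_nonneg (H u - h)),
    mul_le_mul_of_nonneg_right hmβ (sq_nonneg (C u - c))]
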